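/- For every real x > 0, the Rogers–Ramanujan continued fraction satisfies R(e^{−x}) = e^{−x/5} · (∑_{n ∈ ℤ} (−1)ⁿ e^{−(5x/2)n² − (3x/2)n}) / (∑_{n ∈ ℤ} (−1)ⁿ e^{−(5x/2)n² − (x/2)n}); that is, R(e^{−x}) equals e^{−x/5} times the ratio θ₄(3ix/4, e^{−5x/2}) / θ₄(ix/4, e^{−5x/2}) of Jacobi theta functions θ₄(z, q) = ∑_{n∈ℤ} (−1)ⁿ q^{n²} e^{2inz}. -/

import Mathlib

/-- The Legendre symbol modulo 5 as an integer-valued function. -/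
def chi5 (n : ℕ) : ℤ :=
  if n % 5 = 1 ∨ n % 5 = 4 then 1
  else if n % 5 = 2 ∨ n % 5 = 3 then -1
  else 0

/-- The Rogers–Ramanujan continued fraction, given by its product representation
`R(q) = q^{1/5} ∏_{n=1}^∞ (1 - q^n)^{χ₅(n)}`. -/
noncomputable def RR (q : ℝ) : ℝ :=
  q ^ ((1 : ℝ) / 5) * ∏' n : ℕ, (1 - q ^ (n + 1)) ^ chi5 (n + 1)

open Filter Topology Finset

/-- The Gaussian binomial coefficient, defined by the `q`-Pascal recursion. -/
def gaussBinom (q : ℝ) : ℕ → ℕ → ℝ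
  | _, 0 => 1
  | 0, _ + 1 => 0
  | n + 1, k + 1 => gaussBinom q n (k + 1) + q ^ (n - k) * gaussBinom q n k

/-- The finite `q`-Pochhammer product `(q; q)_n`. -/
def qFactorial (q : ℝ) (n : ℕ) : ℝ := ∏ k ∈ range n, (1 - q ^ (k + 1))

theorem gaussBinom_zero_right (q : ℝ) (n : ℕ) : gaussBinom q n 0 = 1 := by
  cases n <;> rfl

theorem gaussBinom_succ_succ (q : ℝ) (n k : ℕ) :
    gaussBinom q (n + 1) (k + 1) =
      gaussBinom q n (k + 1) + q ^ (n - k) * gaussBinom q n k := rfl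

theorem gaussBinom_eq_zero_of_lt (q : ℝ) {n k : ℕ} (h : n < k) : gaussBinom q n k = 0 := by
  induction n generalizing k with
  | zero => obtain ⟨k, rfl⟩ := Nat.exists_eq_succ_of_ne_zero h.ne'; rfl
  | succ n ih =>
    obtain ⟨k, rfl⟩ := Nat.exists_eq_succ_of_ne_zero (Nat.ne_zero_of_lt h)
    rw [Nat.succ_eq_add_one, gaussBinom_succ_succ, ih (by omega), ih (by omega)]
    simp

theorem gaussBinom_mul_qFactorial (q : ℝ) (k m : ℕ) :
    gaussBinom q (k + m) k * qFactorial q k * qFactorial q m = qFactorial q (k + m) := by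
  induction h : k + m generalizing k m with
  | zero =>
    obtain ⟨rfl, rfl⟩ : k = 0 ∧ m = 0 := by omega
    simp [gaussBinom_zero_right, qFactorial]
  | succ n ih =>
    rcases k with _ | k
    · obtain rfl : m = n + 1 := by omega
      simp [gaussBinom_zero_right, qFactorial]
    have hs (j : ℕ) : qFactorial q (j + 1) = qFactorial q j * (1 - q ^ (j + 1)) :=
      prod_range_succ _ _
    have h1 := ih k m (by omega)
    rw [gaussBinom_succ_succ]
    rcases m with _ | m
    · obtain rfl : k = n := by omega
      rw [gaussBinom_eq_zero_of_lt q (Nat.lt_succ_self k), hs]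
      simp only [Nat.sub_self, pow_zero]
      linear_combination (1 - q ^ (k + 1)) * h1
    · have h2 := ih (k + 1) m (by omega)
      obtain rfl : n = k + (m + 1) := by omega
      have e : k + (m + 1) - k = m + 1 := by omega
      rw [e, hs (k + (m + 1))]
      rw [hs m] at h1 ⊢
      rw [hs k] at h2 ⊢
      linear_combination (1 - q ^ (m + 1)) * h2 + q ^ (m + 1) * (1 - q ^ (k + 1)) * h1

/-- The finite `q`-binomial theorem. -/
theorem prod_one_add_mul_pow_eq_sum_gaussBinom (q z : ℝ) (n : ℕ) :
    ∏ k ∈ range n, (1 + z * q ^ k) =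
      ∑ j ∈ range (n + 1), gaussBinom q n j * q ^ (j.choose 2) * z ^ j := by
  induction n with
  | zero => simp [gaussBinom_zero_right]
  | succ n ih =>
    rw [prod_range_succ, ih, sum_range_succ' _ (n + 1)]
    have h (j : ℕ) (hj : j ∈ range (n + 1)) :
        gaussBinom q (n + 1) (j + 1) * q ^ ((j + 1).choose 2) * z ^ (j + 1) =
          gaussBinom q n (j + 1) * q ^ ((j + 1).choose 2) * z ^ (j + 1) +
            gaussBinom q n j * q ^ (j.choose 2) * z ^ j * (z * q ^ n) := by
      have hj' : n - j + j = n := by have := mem_range.1 hj; omega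
      have hc : (j + 1).choose 2 = j + j.choose 2 := by
        rw [Nat.choose_succ_succ' j 1, Nat.choose_one_right]
      have hq : q ^ n = q ^ (n - j) * q ^ j := by rw [← pow_add, hj']
      rw [gaussBinom_succ_succ, hc, hq, pow_add]
      ring
    rw [sum_congr rfl h, sum_add_distrib, ← sum_mul, mul_add, mul_one]
    have h3 := sum_range_succ' (fun j ↦ gaussBinom q n j * q ^ (j.choose 2) * z ^ j) (n + 1)
    rw [sum_range_succ, gaussBinom_eq_zero_of_lt q (Nat.lt_succ_self n)] at h3
    simp only [gaussBinom_zero_right] at h3 ⊢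
    linear_combination h3

theorem qFactorial_nonneg_le_one {q : ℝ} (hq0 : 0 ≤ q) (hq1 : q ≤ 1) (n : ℕ) :
    0 ≤ qFactorial q n ∧ qFactorial q n ≤ 1 :=
  ⟨prod_nonneg fun _ _ ↦ sub_nonneg.2 (pow_le_one₀ hq0 hq1),
    prod_le_one (fun _ _ ↦ sub_nonneg.2 (pow_le_one₀ hq0 hq1))
      fun _ _ ↦ sub_le_self _ (pow_nonneg hq0 _)⟩

theorem summable_log_one_sub_pow {q : ℝ} (hq0 : 0 < q) (hq1 : q < 1) :
    Summable fun k : ℕ ↦ Real.log (1 - q ^ (k + 1)) := by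
  have h : Summable fun k : ℕ ↦ -q ^ (k + 1) :=
    ((summable_nat_add_iff 1).2 (summable_geometric_of_lt_one hq0.le hq1)).neg
  simpa [sub_eq_add_neg] using Real.summable_log_one_add_of_summable h

theorem exists_tendsto_qFactorial {q : ℝ} (hq0 : 0 < q) (hq1 : q < 1) :
    ∃ c, 0 < c ∧ (∀ n, c ≤ qFactorial q n) ∧ Tendsto (qFactorial q) atTop (𝓝 c) := by
  have hp (k : ℕ) : 0 < 1 - q ^ (k + 1) := sub_pos.2 (pow_lt_one₀ hq0.le hq1 (by omega))
  have ht := (Real.hasProd_of_hasSum_log hp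
    (summable_log_one_sub_pow hq0 hq1).hasSum).tendsto_prod_nat
  refine ⟨_, Real.exp_pos _, fun n ↦ ?_, ht⟩
  refine Antitone.le_of_tendsto (antitone_nat_of_succ_le fun m ↦ ?_) ht n
  rw [prod_range_succ]
  exact mul_le_of_le_one_right (prod_nonneg fun k _ ↦ (hp k).le)
    (sub_le_self _ (pow_nonneg hq0.le _))

theorem gaussBinom_eq_div {q : ℝ} (hq0 : 0 < q) (hq1 : q < 1) (k m : ℕ) :
    gaussBinom q (k + m) k = qFactorial q (k + m) / (qFactorial q k * qFactorial q m) := by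
  obtain ⟨c, hc, hle, -⟩ := exists_tendsto_qFactorial hq0 hq1
  have h1 := hc.trans_le (hle k)
  have h2 := hc.trans_le (hle m)
  rw [eq_div_iff (by positivity), ← mul_assoc, gaussBinom_mul_qFactorial]

theorem exists_abs_gaussBinom_le {q : ℝ} (hq0 : 0 < q) (hq1 : q < 1) :
    ∃ C, ∀ n k, |gaussBinom q n k| ≤ C := by
  obtain ⟨c, hc, hle, -⟩ := exists_tendsto_qFactorial hq0 hq1
  refine ⟨1 / (c * c), fun n k ↦ ?_⟩
  rcases lt_or_ge n k with h | h
  · rw [gaussBinom_eq_zero_of_lt q h, abs_zero]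
    positivity
  · obtain ⟨m, rfl⟩ := Nat.exists_eq_add_of_le h
    have h1 := hle k
    have h2 := hle m
    have h3 := qFactorial_nonneg_le_one hq0.le hq1.le (k + m)
    have h4 : 0 < qFactorial q k := hc.trans_le h1
    have h5 : 0 < qFactorial q m := hc.trans_le h2
    rw [gaussBinom_eq_div hq0 hq1, abs_of_nonneg (div_nonneg h3.1 (by positivity))]
    exact div_le_div₀ zero_le_one h3.2 (by positivity) (by gcongr)

/-- The general term of the theta series `∑ (-1)ⁿ Q^{n(n-1)/2} wⁿ` at `Q = e^{-y}`,
`w = e^{-u}`. -/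
noncomputable def thetaTerm (y u : ℝ) (n : ℤ) : ℝ :=
  (-1) ^ n * Real.exp (-(y * (n * (n - 1) / 2)) - u * n)

/-- The partial products of `∏ (1 - w Q^k) (1 - w⁻¹ Q^{k+1})` at `Q = e^{-y}`, `w = e^{-u}`. -/
noncomputable def thetaProd (y u : ℝ) (N : ℕ) : ℝ :=
  ∏ k ∈ range N, (1 - Real.exp (-(y * k) - u)) * (1 - Real.exp (u - y * (k + 1)))

theorem prod_one_sub_exp_eq (y u : ℝ) (N : ℕ) :
    ∏ i ∈ range N, (1 - Real.exp (y * (i + 1) - u)) =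
      (-1) ^ N * Real.exp (y * (N * (N + 1) / 2) - N * u) *
        ∏ i ∈ range N, (1 - Real.exp (u - y * (i + 1))) := by
  induction N with
  | zero => simp
  | succ N ih =>
    rw [prod_range_succ, prod_range_succ, ih]
    have h1 : Real.exp (y * (((N + 1 : ℕ) : ℝ) * ((N + 1 : ℕ) + 1) / 2) - (N + 1 : ℕ) * u) =
        Real.exp (y * (N * (N + 1) / 2) - N * u) * Real.exp (y * (N + 1) - u) := by
      rw [← Real.exp_add]; push_cast; congr 1; ring
    have h2 : Real.exp (y * (N + 1) - u) * Real.exp (u - y * (N + 1)) = 1 := by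
      rw [← Real.exp_add]; simp
    rw [h1, pow_succ]
    linear_combination (-1) ^ N * Real.exp (y * (N * (N + 1) / 2) - N * u) *
      (∏ i ∈ range N, (1 - Real.exp (u - y * (i + 1)))) * (-h2)

/-- The finite form of the Jacobi triple product identity. -/
theorem thetaProd_eq_sum (y u : ℝ) (N : ℕ) :
    thetaProd y u N = ∑ j ∈ range (2 * N + 1),
      gaussBinom (Real.exp (-y)) (2 * N) j * thetaTerm y u ((j : ℤ) - N) := by
  have key := prod_one_add_mul_pow_eq_sum_gaussBinom (Real.exp (-y)) (-Real.exp (y * N - u))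
    (2 * N)
  rw [two_mul, prod_range_add, ← prod_range_reflect] at key
  have h1 : ∏ j ∈ range N, (1 + -Real.exp (y * N - u) * Real.exp (-y) ^ (N - 1 - j)) =
      ∏ i ∈ range N, (1 - Real.exp (y * (i + 1) - u)) := by
    refine prod_congr rfl fun i hi ↦ ?_
    have hN : N = (N - 1 - i) + (i + 1) := by have := mem_range.1 hi; omega
    have hN' : (N : ℝ) = ((N - 1 - i : ℕ) : ℝ) + (i + 1) := by exact_mod_cast hN
    rw [← Real.exp_nat_mul, neg_mul, ← Real.exp_add, ← sub_eq_add_neg]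
    congr 2
    linear_combination y * hN'
  have h2 : ∏ j ∈ range N, (1 + -Real.exp (y * N - u) * Real.exp (-y) ^ (N + j)) =
      ∏ k ∈ range N, (1 - Real.exp (-(y * k) - u)) := by
    refine prod_congr rfl fun i _ ↦ ?_
    rw [← Real.exp_nat_mul, neg_mul, ← Real.exp_add, ← sub_eq_add_neg]
    congr 2
    push_cast
    ring
  rw [h1, h2, prod_one_sub_exp_eq] at key
  have hne : (-1 : ℝ) ^ N * Real.exp (y * (N * (N + 1) / 2) - N * u) ≠ 0 :=
    mul_ne_zero (pow_ne_zero _ (by norm_num)) (Real.exp_pos _).ne'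
  apply mul_left_cancel₀ hne
  rw [thetaProd, prod_mul_distrib, mul_comm (∏ k ∈ range N, _), ← mul_assoc, key, mul_sum,
    two_mul]
  refine sum_congr rfl fun j _ ↦ ?_
  have hs : (-1 : ℝ) ^ N * (-1) ^ ((j : ℤ) - N) = (-1) ^ j := by
    rw [← zpow_natCast, ← zpow_add₀ (by norm_num)]
    simp
  have he : Real.exp (y * (N * (N + 1) / 2) - N * u) *
      Real.exp (-(y * ((((j : ℤ) - N : ℤ) : ℝ) * ((((j : ℤ) - N : ℤ) : ℝ) - 1) / 2)) -
        u * (((j : ℤ) - N : ℤ) : ℝ)) =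
      Real.exp (-y) ^ (j.choose 2) * Real.exp (y * N - u) ^ j := by
    rw [← Real.exp_nat_mul, ← Real.exp_nat_mul, ← Real.exp_add, ← Real.exp_add,
      Nat.cast_choose_two]
    congr 1
    push_cast
    ring
  rw [thetaTerm, neg_pow (Real.exp _)]
  linear_combination
    -(gaussBinom (Real.exp (-y)) (N + N) j * (-1) ^ j) * he -
    gaussBinom (Real.exp (-y)) (N + N) j * Real.exp (y * (N * (N + 1) / 2) - N * u) *
      Real.exp (-(y * ((((j : ℤ) - N : ℤ) : ℝ) * ((((j : ℤ) - N : ℤ) : ℝ) - 1) / 2)) -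
        u * (((j : ℤ) - N : ℤ) : ℝ)) * hs

theorem summable_thetaTerm {y u : ℝ} (hu : 0 < u) (huy : u < y) : Summable (thetaTerm y u) := by
  have geom {c : ℝ} (hc : 0 < c) : Summable fun n : ℕ ↦ Real.exp (-c) ^ n :=
    summable_geometric_of_lt_one (Real.exp_pos _).le (by simpa using hc)
  refine Summable.of_nat_of_neg (Summable.of_norm_bounded (geom hu) fun n ↦ ?_)
    (Summable.of_norm_bounded (geom (sub_pos.2 huy)) fun n ↦ ?_)
  all_goals
    rw [thetaTerm, norm_mul, norm_zpow, norm_neg, norm_one, one_zpow, one_mul,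
      Real.norm_of_nonneg (Real.exp_pos _).le, ← Real.exp_nat_mul, Real.exp_le_exp]
    push_cast
    have hn : (0 : ℝ) ≤ n * (n - 1) := by
      rcases n with _ | n
      · simp
      · push_cast; simp only [add_sub_cancel_right]; positivity
    nlinarith [mul_nonneg (hu.trans huy).le hn]

/-- The Jacobi triple product identity, with the factor `(Q; Q)_∞` moved to the side of the
series. -/
theorem tendsto_thetaProd {y u : ℝ} (hu : 0 < u) (huy : u < y) {c : ℝ} (hc : 0 < c)
    (ht : Tendsto (qFactorial (Real.exp (-y))) atTop (𝓝 c)) :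
    Tendsto (thetaProd y u) atTop (𝓝 (c⁻¹ * ∑' n, thetaTerm y u n)) := by
  set q := Real.exp (-y)
  have hq0 : 0 < q := Real.exp_pos _
  have hq1 : q < 1 := by simpa [q] using hu.trans huy
  obtain ⟨C, hC⟩ := exists_abs_gaussBinom_le hq0 hq1
  let f (N : ℕ) (n : ℤ) : ℝ :=
    if 0 ≤ n + N then gaussBinom q (2 * N) (n + N).toNat * thetaTerm y u n else 0
  have hf (N : ℕ) : thetaProd y u N = ∑' n, f N n := by
    let e : ℕ ↪ ℤ := ⟨fun j ↦ (j : ℤ) - N, fun a b h ↦ by simpa using h⟩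
    rw [tsum_eq_sum (s := (range (2 * N + 1)).map e), sum_map, thetaProd_eq_sum]
    · refine sum_congr rfl fun j _ ↦ ?_
      have he : e j = (j : ℤ) - N := rfl
      simp [f, he, q]
    · intro n hn
      by_cases h : 0 ≤ n + N
      · have : 2 * N < (n + N).toNat := by
          by_contra! hlt
          refine hn (mem_map.2 ⟨(n + N).toNat, mem_range.2 (by omega), ?_⟩)
          change ((n + N).toNat : ℤ) - N = n
          omega
        simp [f, gaussBinom_eq_zero_of_lt q this]
      · simp [f, h]
  rw [funext hf, ← tsum_mul_left]
  refine tendsto_tsum_of_dominated_convergence ((summable_thetaTerm hu huy).norm.mul_left C)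
    (fun n ↦ ?_) (Eventually.of_forall fun N n ↦ ?_)
  · have t1 : Tendsto (fun N : ℕ ↦ (n + N).toNat) atTop atTop :=
      tendsto_atTop.2 fun b ↦ (eventually_ge_atTop (b + n.natAbs)).mono fun N hN ↦ by omega
    have t2 : Tendsto (fun N : ℕ ↦ (N - n).toNat) atTop atTop :=
      tendsto_atTop.2 fun b ↦ (eventually_ge_atTop (b + n.natAbs)).mono fun N hN ↦ by omega
    have t3 : Tendsto (fun N : ℕ ↦ 2 * N) atTop atTop :=
      tendsto_atTop.2 fun b ↦ (eventually_ge_atTop b).mono fun N hN ↦ by omega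
    have hlim := (((ht.comp t3).div ((ht.comp t1).mul (ht.comp t2))
      (mul_pos hc hc).ne').mul_const (thetaTerm y u n))
    rw [show c / (c * c) = c⁻¹ by field_simp] at hlim
    refine hlim.congr' ((eventually_ge_atTop n.natAbs).mono fun N hN ↦ ?_)
    have e : 2 * N = (n + N).toNat + (N - n).toNat := by omega
    have h0 : 0 ≤ n + N := by omega
    simp only [f, h0, if_true, Function.comp, Pi.div_apply]
    rw [e, gaussBinom_eq_div hq0 hq1]
  · by_cases h : 0 ≤ n + N
    · simp only [f, h, if_true, norm_mul]
      exact mul_le_mul_of_nonneg_right (hC _ _) (norm_nonneg _)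
    · simp only [f, h, if_false, norm_zero]
      exact mul_nonneg ((abs_nonneg _).trans (hC 0 0)) (norm_nonneg _)

theorem multipliable_one_sub_pow_zpow_chi5 {q : ℝ} (hq0 : 0 < q) (hq1 : q < 1) :
    Multipliable fun n : ℕ ↦ (1 - q ^ (n + 1)) ^ chi5 (n + 1) := by
  have hp (k : ℕ) : 0 < 1 - q ^ (k + 1) := sub_pos.2 (pow_lt_one₀ hq0.le hq1 (by omega))
  refine Real.multipliable_of_summable_log (fun n ↦ zpow_pos (hp n) _) ?_
  refine Summable.of_norm_bounded (summable_log_one_sub_pow hq0 hq1).norm fun n ↦ ?_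
  rw [Real.log_zpow, norm_mul]
  refine mul_le_of_le_one_left (norm_nonneg _) ?_
  unfold chi5
  split_ifs <;> simp

theorem prod_range_one_sub_pow_zpow_chi5 (x : ℝ) (M : ℕ) :
    ∏ n ∈ range (5 * M), (1 - Real.exp (-x) ^ (n + 1)) ^ chi5 (n + 1) =
      thetaProd (5 * x) (4 * x) M / thetaProd (5 * x) (3 * x) M := by
  induction M with
  | zero => simp [thetaProd]
  | succ M ih =>
    have c1 : chi5 (5 * M + 1) = 1 := by unfold chi5; grind
    have c2 : chi5 (5 * M + 1 + 1) = -1 := by unfold chi5; grind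
    have c3 : chi5 (5 * M + 2 + 1) = -1 := by unfold chi5; grind
    have c4 : chi5 (5 * M + 3 + 1) = 1 := by unfold chi5; grind
    have c5 : chi5 (5 * M + 4 + 1) = 0 := by unfold chi5; grind
    have e1 : Real.exp (3 * x - 5 * x * (M + 1)) = Real.exp (-x) ^ (5 * M + 1 + 1) := by
      rw [← Real.exp_nat_mul]; congr 1; push_cast; ring
    have e2 : Real.exp (-(5 * x * M) - 3 * x) = Real.exp (-x) ^ (5 * M + 2 + 1) := by
      rw [← Real.exp_nat_mul]; congr 1; push_cast; ring
    have e3 : Real.exp (-(5 * x * M) - 4 * x) = Real.exp (-x) ^ (5 * M + 3 + 1) := by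
      rw [← Real.exp_nat_mul]; congr 1; push_cast; ring
    have e4 : Real.exp (4 * x - 5 * x * (M + 1)) = Real.exp (-x) ^ (5 * M + 1) := by
      rw [← Real.exp_nat_mul]; congr 1; push_cast; ring
    have hT (u : ℝ) : thetaProd (5 * x) u (M + 1) = thetaProd (5 * x) u M *
        ((1 - Real.exp (-(5 * x * M) - u)) * (1 - Real.exp (u - 5 * x * (M + 1)))) :=
      prod_range_succ _ _
    rw [show 5 * (M + 1) = 5 * M + 4 + 1 by ring, prod_range_succ, prod_range_succ _ (5 * M + 3),
      prod_range_succ _ (5 * M + 2), prod_range_succ _ (5 * M + 1), prod_range_succ _ (5 * M), ih,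
      c1, c2, c3, c4, c5, hT, hT, e1, e2, e3, e4]
    simp only [zpow_one, zpow_neg, zpow_zero, div_eq_mul_inv, mul_inv]
    ring

theorem thetaProd_pos_bound {x : ℝ} (hx : 0 < x) :
    ∃ c, 0 < c ∧ ∀ M, c ≤ thetaProd (5 * x) (3 * x) M := by
  have hq1 : Real.exp (-x) < 1 := by simpa using hx
  obtain ⟨c, hc, hle, -⟩ := exists_tendsto_qFactorial (Real.exp_pos (-x)) hq1
  refine ⟨c * c, mul_pos hc hc, fun M ↦
    (mul_le_mul (hle M) (hle M) hc.le (hc.le.trans (hle M))).trans ?_⟩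
  rw [qFactorial, thetaProd, ← prod_mul_distrib]
  have h0 (k : ℕ) : 0 ≤ 1 - Real.exp (-x) ^ (k + 1) :=
    sub_nonneg.2 (pow_le_one₀ (Real.exp_pos _).le hq1.le)
  refine prod_le_prod (fun k _ ↦ mul_nonneg (h0 k) (h0 k)) fun k _ ↦ ?_
  have h1 : 1 - Real.exp (-x) ^ (k + 1) ≤ 1 - Real.exp (-(5 * x * k) - 3 * x) := by
    rw [← Real.exp_nat_mul]
    gcongr
    push_cast
    nlinarith [mul_nonneg hx.le k.cast_nonneg]
  have h2 : 1 - Real.exp (-x) ^ (k + 1) ≤ 1 - Real.exp (3 * x - 5 * x * (k + 1)) := by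
    rw [← Real.exp_nat_mul]
    gcongr
    push_cast
    nlinarith [mul_nonneg hx.le k.cast_nonneg]
  exact mul_le_mul h1 h2 (h0 k) ((h0 k).trans h1)

theorem RR_eq_theta_ratio (x : ℝ) (hx : 0 < x) :
    RR (Real.exp (-x)) =
      Real.exp (-x / 5) *
        (∑' n : ℤ, (-1 : ℝ) ^ n * Real.exp (-(5 * x / 2) * n ^ 2 - 3 * x / 2 * n)) /
        (∑' n : ℤ, (-1 : ℝ) ^ n * Real.exp (-(5 * x / 2) * n ^ 2 - x / 2 * n)) := by
  have hq1 : Real.exp (-x) < 1 := by simpa using hx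
  have hQ1 : Real.exp (-(5 * x)) < 1 := by simpa using hx
  obtain ⟨c, hc, -, ht⟩ := exists_tendsto_qFactorial (Real.exp_pos (-(5 * x))) hQ1
  obtain ⟨d, hd, hle⟩ := thetaProd_pos_bound hx
  have h4 := tendsto_thetaProd (y := 5 * x) (u := 4 * x) (by linarith) (by linarith) hc ht
  have h3 := tendsto_thetaProd (y := 5 * x) (u := 3 * x) (by linarith) (by linarith) hc ht
  have hne := (hd.trans_le (ge_of_tendsto' h3 hle)).ne'
  have hprod := (multipliable_one_sub_pow_zpow_chi5 (Real.exp_pos (-x)) hq1).hasProd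
    |>.tendsto_prod_nat
  have h5 : Tendsto (fun M : ℕ ↦ 5 * M) atTop atTop :=
    tendsto_atTop.2 fun b ↦ (eventually_ge_atTop b).mono fun N hN ↦ by omega
  have heq := tendsto_nhds_unique (hprod.comp h5)
    ((h4.div h3 hne).congr fun M ↦ (prod_range_one_sub_pow_zpow_chi5 x M).symm)
  rw [mul_div_mul_left _ _ (inv_ne_zero hc.ne')] at heq
  have e4 (n : ℤ) : thetaTerm (5 * x) (4 * x) n =
      (-1 : ℝ) ^ n * Real.exp (-(5 * x / 2) * n ^ 2 - 3 * x / 2 * n) := by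
    rw [thetaTerm]; congr 2; ring
  have e3 (n : ℤ) : thetaTerm (5 * x) (3 * x) n =
      (-1 : ℝ) ^ n * Real.exp (-(5 * x / 2) * n ^ 2 - x / 2 * n) := by
    rw [thetaTerm]; congr 2; ring
  simp only [e4, e3] at heq
  rw [RR, heq, ← Real.exp_mul, mul_one_div, mul_div_assoc (Real.exp _)]
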